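/- For every integer m ≥ 2 there exists a constant C_m > 0 such that for every divergence-free Schwartz vector field u : ℝ³ → ℝ³, | ∫_{ℝ³} ⟨ ((I−Δ)^m u)(x), (u·∇)u(x) ⟩ dx | ≤ ¼ ‖u‖_{m+1}² + C_m ‖u‖_{m−1}^{10}, where (I−Δ)^m u is the m-fold iterate of the map v ↦ v − Δv (componentwise Laplacian) applied to u. (This is the higher-order transport estimate −⟨u, P((u·∇)u)⟩_m ≤ ¼‖u‖_{m+1}² + C_m‖u‖_{m−1}^{10} from the proof of Lemma 6.3 — for divergence-free u the Leray projection P drops out of the pairing — proved via the Moser-type calculus inequality, Agmon's inequality and interpolation.) -/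

import Mathlib

open MeasureTheory

/-- Squared Sobolev `H^s`-norm of a Schwartz vector field `u : ℝ³ → ℝ³` (given by its
components), `‖u‖_s² = ∑_{j=0}^s ∫ ‖D^j u(x)‖² dx` with `‖·‖` the Frobenius norm of the
`j`-th total derivative, computed in coordinates on the standard orthonormal basis. -/
noncomputable def sobNormSq (s : ℕ)
    (u : Fin 3 → SchwartzMap (EuclideanSpace ℝ (Fin 3)) ℝ) : ℝ :=
  ∑ j ∈ Finset.range (s + 1), ∫ x, ∑ k, ∑ i : Fin j → Fin 3,
    (iteratedFDeriv ℝ j (fun y => u k y) x (fun l => EuclideanSpace.single (i l) 1)) ^ 2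

/-- The operator `v ↦ v − Δv` on scalar functions on `ℝ³`, with the Laplacian written
via iterated directional derivatives. -/
noncomputable def oneMinusLaplacian (f : EuclideanSpace ℝ (Fin 3) → ℝ) :
    EuclideanSpace ℝ (Fin 3) → ℝ :=
  fun x => f x - ∑ i, fderiv ℝ (fun y => fderiv ℝ f y (EuclideanSpace.single i 1)) x
    (EuclideanSpace.single i 1)

open SchwartzMap LineDeriv FourierTransform

/-- The partial derivative of a Schwartz function on `ℝ³` along the `i`-th coordinate. -/
noncomputable abbrev coordDeriv {F : Type*} [NormedAddCommGroup F] [NormedSpace ℝ F] (i : Fin 3)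
    (f : 𝓢(EuclideanSpace ℝ (Fin 3), F)) : 𝓢(EuclideanSpace ℝ (Fin 3), F) :=
  ∂_{EuclideanSpace.single i (1 : ℝ)} f

theorem sq_le_of_forall_pos_le_mul_add_div {X Y z : ℝ} (hX : 0 ≤ X) (hY : 0 ≤ Y) (hz : 0 ≤ z)
    (h : ∀ t : ℝ, 0 < t → z ≤ t * X + Y / t) : z ^ 2 ≤ 4 * X * Y := by
  have key : ∀ t : ℝ, 0 ≤ X * (t * t) + (-z) * t + Y := by
    intro t
    rcases le_or_gt t 0 with ht | ht
    · nlinarith [mul_nonneg hX (mul_self_nonneg t), mul_nonneg hz (neg_nonneg.2 ht)]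
    · have h1 := mul_le_mul_of_nonneg_right (h t ht) ht.le
      have h2 : (t * X + Y / t) * t = X * (t * t) + Y := by field_simp
      linarith
  have := discrim_le_zero key
  simp only [discrim] at this
  linarith

/-- The radial weight interpolating between the `H¹` and the `H²` norm. -/
noncomputable def agmonWeight (t r : ℝ) : ℝ := (1 + r ^ 2) * (t + r ^ 2 / t)

theorem agmonWeight_pos {t : ℝ} (ht : 0 < t) (r : ℝ) : 0 < agmonWeight t r := by
  unfold agmonWeight; positivity

theorem sq_mul_inv_agmonWeight_le {t : ℝ} (ht : 0 < t) (r : ℝ) :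
    r ^ 2 * (agmonWeight t r)⁻¹ ≤ t⁻¹ * (1 + (t⁻¹ * r) ^ 2)⁻¹ := by
  have h : t⁻¹ * (1 + (t⁻¹ * r) ^ 2)⁻¹ = (t + r ^ 2 / t)⁻¹ := by
    rw [← mul_inv]; congr 1; field_simp
  rw [h, agmonWeight, mul_inv, ← mul_assoc]
  refine mul_le_of_le_one_left (by positivity) ?_
  rw [← div_eq_mul_inv, div_le_one (by positivity)]
  linarith

theorem integrableOn_inv_one_add_sq_scaled {t : ℝ} (ht : 0 < t) :
    IntegrableOn (fun r : ℝ => t⁻¹ * (1 + (t⁻¹ * r) ^ 2)⁻¹) (Set.Ioi 0) :=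
  ((integrable_inv_one_add_sq.comp_mul_left' (inv_pos.2 ht).ne').const_mul _).integrableOn

theorem continuous_inv_agmonWeight {t : ℝ} (ht : 0 < t) :
    Continuous fun r => (agmonWeight t r)⁻¹ := by
  refine Continuous.inv₀ ?_ fun r => (agmonWeight_pos ht r).ne'
  unfold agmonWeight
  fun_prop

theorem integrableOn_sq_mul_inv_agmonWeight {t : ℝ} (ht : 0 < t) :
    IntegrableOn (fun r : ℝ => r ^ 2 * (agmonWeight t r)⁻¹) (Set.Ioi 0) := by
  refine (integrableOn_inv_one_add_sq_scaled ht).mono'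
    ((continuous_pow 2).mul (continuous_inv_agmonWeight ht)).aestronglyMeasurable
    (.of_forall fun r => ?_)
  rw [Real.norm_of_nonneg (mul_nonneg (sq_nonneg r) (inv_nonneg.2 (agmonWeight_pos ht r).le))]
  exact sq_mul_inv_agmonWeight_le ht r

theorem integrable_inv_agmonWeight {t : ℝ} (ht : 0 < t) :
    Integrable fun ξ : EuclideanSpace ℝ (Fin 3) => (agmonWeight t ‖ξ‖)⁻¹ := by
  rw [integrable_fun_norm_addHaar volume (f := fun r => (agmonWeight t r)⁻¹)]
  simpa using integrableOn_sq_mul_inv_agmonWeight ht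

theorem exists_integral_inv_agmonWeight_le :
    ∃ K : ℝ, 0 ≤ K ∧ ∀ t : ℝ, 0 < t →
      ∫ ξ : EuclideanSpace ℝ (Fin 3), (agmonWeight t ‖ξ‖)⁻¹ ≤ K := by
  refine ⟨3 * (volume.real (Metric.ball (0 : EuclideanSpace ℝ (Fin 3)) 1) * (Real.pi / 2)),
    by positivity, fun t ht => ?_⟩
  rw [integral_fun_norm_addHaar volume fun r => (agmonWeight t r)⁻¹]
  simp only [finrank_euclideanSpace, Fintype.card_fin, nsmul_eq_mul, smul_eq_mul, Nat.cast_ofNat,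
    Nat.add_one_sub_one]
  gcongr
  calc ∫ r in Set.Ioi (0 : ℝ), r ^ 2 * (agmonWeight t r)⁻¹
      ≤ ∫ r in Set.Ioi (0 : ℝ), t⁻¹ * (1 + (t⁻¹ * r) ^ 2)⁻¹ :=
        integral_mono (integrableOn_sq_mul_inv_agmonWeight ht)
          (integrableOn_inv_one_add_sq_scaled ht) (sq_mul_inv_agmonWeight_le ht)
    _ = Real.pi / 2 := by
        rw [integral_const_mul, integral_comp_mul_left_Ioi (fun r => (1 + r ^ 2)⁻¹) 0 (inv_pos.2 ht)]
        simp [integral_Ioi_inv_one_add_sq, ht.ne']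

theorem SchwartzMap.integrable_sq (f : 𝓢(EuclideanSpace ℝ (Fin 3), ℝ)) :
    Integrable fun x => f x ^ 2 := by
  simpa using (f.memLp 2).integrable_norm_pow (by norm_num)

theorem SchwartzMap.integrable_norm_sq (f : 𝓢(EuclideanSpace ℝ (Fin 3), ℂ)) :
    Integrable fun x => ‖f x‖ ^ 2 := by
  simpa using (f.memLp 2).integrable_norm_pow (by norm_num)

theorem norm_apply_le_integral_norm_fourier (f : 𝓢(EuclideanSpace ℝ (Fin 3), ℂ))
    (x : EuclideanSpace ℝ (Fin 3)) : ‖f x‖ ≤ ∫ ξ, ‖𝓕 f ξ‖ := by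
  conv_lhs => rw [← FourierTransform.fourierInv_fourier_eq (F := 𝓢(EuclideanSpace ℝ (Fin 3), ℂ)) f]
  rw [SchwartzMap.fourierInv_coe, Real.fourierInv_eq]
  refine (norm_integral_le_integral_norm _).trans_eq ?_
  simp

theorem norm_fourier_lineDeriv_sq (f : 𝓢(EuclideanSpace ℝ (Fin 3), ℂ)) (i : Fin 3)
    (ξ : EuclideanSpace ℝ (Fin 3)) :
    ‖𝓕 (coordDeriv i f) ξ‖ ^ 2
      = (2 * Real.pi) ^ 2 * ξ i ^ 2 * ‖𝓕 f ξ‖ ^ 2 := by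
  have h : (inner ℝ · (EuclideanSpace.single i (1 : ℝ))).HasTemperateGrowth :=
    ((innerSL ℝ).flip (EuclideanSpace.single i (1 : ℝ))).hasTemperateGrowth
  rw [fourier_lineDerivOp_eq, smul_apply, smulLeftCLM_apply_apply h]
  simp [EuclideanSpace.inner_single_right, mul_pow, abs_of_pos Real.pi_pos]
  ring

theorem norm_sq_mul_norm_fourier_sq_le (f : 𝓢(EuclideanSpace ℝ (Fin 3), ℂ))
    (ξ : EuclideanSpace ℝ (Fin 3)) :
    ‖ξ‖ ^ 2 * ‖𝓕 f ξ‖ ^ 2 ≤ ∑ i, ‖𝓕 (coordDeriv i f) ξ‖ ^ 2 := by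
  simp_rw [norm_fourier_lineDeriv_sq, ← Finset.sum_mul, ← Finset.mul_sum]
  gcongr
  have h : ‖ξ‖ ^ 2 = ∑ i, ξ i ^ 2 := by simp [EuclideanSpace.norm_sq_eq]
  rw [h]
  refine le_mul_of_one_le_left (by positivity) ?_
  nlinarith [Real.pi_gt_three]

/-- The Fourier-side density of the squared `H¹` norm. -/
noncomputable def fourierDensity (g : 𝓢(EuclideanSpace ℝ (Fin 3), ℂ))
    (ξ : EuclideanSpace ℝ (Fin 3)) : ℝ :=
  ‖𝓕 g ξ‖ ^ 2 + ∑ i, ‖𝓕 (coordDeriv i g) ξ‖ ^ 2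

theorem integrable_sum_norm_fourier_sq (g : 𝓢(EuclideanSpace ℝ (Fin 3), ℂ)) :
    Integrable fun ξ => ∑ i, ‖𝓕 (coordDeriv i g) ξ‖ ^ 2 :=
  integrable_finsetSum _ fun i _ => integrable_norm_sq (𝓕 (coordDeriv i g))

theorem integrable_fourierDensity (g : 𝓢(EuclideanSpace ℝ (Fin 3), ℂ)) :
    Integrable (fourierDensity g) :=
  Integrable.add (integrable_norm_sq (𝓕 g)) (integrable_sum_norm_fourier_sq g)

theorem integral_fourierDensity (g : 𝓢(EuclideanSpace ℝ (Fin 3), ℂ)) :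
    ∫ ξ, fourierDensity g ξ = (∫ y, ‖g y‖ ^ 2) + ∑ i, ∫ y, ‖coordDeriv i g y‖ ^ 2 := by
  unfold fourierDensity
  rw [integral_add (integrable_norm_sq (𝓕 g)) (integrable_sum_norm_fourier_sq g),
    integral_finsetSum _ fun i _ => integrable_norm_sq (𝓕 (coordDeriv i g))]
  simp_rw [integral_norm_sq_fourier]

theorem mul_norm_fourier_sq_le_fourierDensity (g : 𝓢(EuclideanSpace ℝ (Fin 3), ℂ))
    (ξ : EuclideanSpace ℝ (Fin 3)) :
    (1 + ‖ξ‖ ^ 2) * ‖𝓕 g ξ‖ ^ 2 ≤ fourierDensity g ξ := by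
  have := norm_sq_mul_norm_fourier_sq_le g ξ
  unfold fourierDensity
  linarith

theorem fourierDensity_nonneg (g : 𝓢(EuclideanSpace ℝ (Fin 3), ℂ))
    (ξ : EuclideanSpace ℝ (Fin 3)) : 0 ≤ fourierDensity g ξ :=
  add_nonneg (sq_nonneg _) (Finset.sum_nonneg fun _ _ => sq_nonneg _)

/-- Agmon's inequality for complex-valued Schwartz functions, in Fourier variables. -/
theorem exists_norm_pow_four_le :
    ∃ C : ℝ, 0 ≤ C ∧ ∀ (f : 𝓢(EuclideanSpace ℝ (Fin 3), ℂ)) (x : EuclideanSpace ℝ (Fin 3)),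
      ‖f x‖ ^ 4 ≤ C * (∫ ξ, fourierDensity f ξ) * ∑ i, ∫ ξ, fourierDensity (coordDeriv i f) ξ := by
  obtain ⟨K, hK0, hK⟩ := exists_integral_inv_agmonWeight_le
  refine ⟨4 * K ^ 2, mul_nonneg (by norm_num) (sq_nonneg K), fun f x => ?_⟩
  set X := ∫ ξ, fourierDensity f ξ
  set Y := ∑ i, ∫ ξ, fourierDensity (coordDeriv i f) ξ
  have hX0 : 0 ≤ X := integral_nonneg (fourierDensity_nonneg f)
  have hY0 : 0 ≤ Y :=
    Finset.sum_nonneg fun i _ => integral_nonneg (fourierDensity_nonneg (coordDeriv i f))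
  have hW : ∀ t : ℝ, 0 < t → ∀ s : ℝ, 0 < s →
      2 * ‖f x‖ ≤ s * K + (t * X + Y / t) / s := by
    intro t ht s hs
    have hS : Integrable fun ξ =>
        ∑ i, fourierDensity (coordDeriv i f) ξ := integrable_finsetSum _ fun i _ => integrable_fourierDensity _
    have hR : Integrable fun ξ =>
        t * fourierDensity f ξ + (∑ i, fourierDensity (coordDeriv i f) ξ) / t :=
      ((integrable_fourierDensity f).const_mul t).add (hS.div_const t)
    have hRint : ∫ ξ, (t * fourierDensity f ξ + (∑ i, fourierDensity (coordDeriv i f) ξ) / t) =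
        t * X + Y / t := by
      rw [integral_add ((integrable_fourierDensity f).const_mul t) (hS.div_const t),
        integral_const_mul, integral_div, integral_finsetSum _ fun i _ => integrable_fourierDensity _]
    have hpt : ∀ ξ, 2 * ‖𝓕 f ξ‖ ≤ s * (agmonWeight t ‖ξ‖)⁻¹ +
        (t * fourierDensity f ξ + (∑ i, fourierDensity (coordDeriv i f) ξ) / t) / s := by
      intro ξ
      have hw := agmonWeight_pos ht ‖ξ‖
      have h1 : agmonWeight t ‖ξ‖ * ‖𝓕 f ξ‖ ^ 2 ≤
          t * fourierDensity f ξ + (∑ i, fourierDensity (coordDeriv i f) ξ) / t := by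
        have h2 : (1 + ‖ξ‖ ^ 2) * (‖ξ‖ ^ 2 * ‖𝓕 f ξ‖ ^ 2) ≤
            ∑ i, fourierDensity (coordDeriv i f) ξ := by
          calc _ ≤ (1 + ‖ξ‖ ^ 2) *
                ∑ i, ‖𝓕 (coordDeriv i f) ξ‖ ^ 2 := by
                gcongr; exact norm_sq_mul_norm_fourier_sq_le f ξ
            _ ≤ _ := by
                rw [Finset.mul_sum]
                exact Finset.sum_le_sum fun i _ => mul_norm_fourier_sq_le_fourierDensity _ ξ
        calc agmonWeight t ‖ξ‖ * ‖𝓕 f ξ‖ ^ 2 = t * ((1 + ‖ξ‖ ^ 2) * ‖𝓕 f ξ‖ ^ 2) +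
              ((1 + ‖ξ‖ ^ 2) * (‖ξ‖ ^ 2 * ‖𝓕 f ξ‖ ^ 2)) / t := by rw [agmonWeight]; ring
          _ ≤ _ := by gcongr; exact mul_norm_fourier_sq_le_fourierDensity f ξ
      have h3 : 2 * ‖𝓕 f ξ‖ ≤ s * (agmonWeight t ‖ξ‖)⁻¹ +
          agmonWeight t ‖ξ‖ * ‖𝓕 f ξ‖ ^ 2 / s := by
        have : s * (agmonWeight t ‖ξ‖)⁻¹ + agmonWeight t ‖ξ‖ * ‖𝓕 f ξ‖ ^ 2 / s - 2 * ‖𝓕 f ξ‖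
          = (s - agmonWeight t ‖ξ‖ * ‖𝓕 f ξ‖) ^ 2 / (s * agmonWeight t ‖ξ‖) := by
          field_simp; ring
        have : 0 ≤ (s - agmonWeight t ‖ξ‖ * ‖𝓕 f ξ‖) ^ 2 / (s * agmonWeight t ‖ξ‖) := by positivity
        linarith
      refine h3.trans ?_
      gcongr
    calc 2 * ‖f x‖ ≤ 2 * ∫ ξ, ‖𝓕 f ξ‖ := by
          gcongr; exact norm_apply_le_integral_norm_fourier f x
      _ = ∫ ξ, 2 * ‖𝓕 f ξ‖ := (integral_const_mul _ _).symm
      _ ≤ ∫ ξ, (s * (agmonWeight t ‖ξ‖)⁻¹ +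
          (t * fourierDensity f ξ + (∑ i, fourierDensity (coordDeriv i f) ξ) / t) / s) :=
          integral_mono ((𝓕 f).integrable.norm.const_mul 2)
            (((integrable_inv_agmonWeight ht).const_mul s).add (hR.div_const s)) hpt
      _ = s * (∫ ξ : EuclideanSpace ℝ (Fin 3), (agmonWeight t ‖ξ‖)⁻¹) + (t * X + Y / t) / s := by
          rw [integral_add ((integrable_inv_agmonWeight ht).const_mul s) (hR.div_const s),
            integral_const_mul, integral_div, hRint]
      _ ≤ _ := by gcongr; exact hK t ht
  clear_value X Y
  have hsq : ∀ t : ℝ, 0 < t → ‖f x‖ ^ 2 ≤ t * (K * X) + K * Y / t := by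
    intro t ht
    have := sq_le_of_forall_pos_le_mul_add_div hK0 (by positivity : 0 ≤ t * X + Y / t)
      (by positivity) (hW t ht)
    have h2 : K * (t * X + Y / t) = t * (K * X) + K * Y / t := by ring
    nlinarith
  have := sq_le_of_forall_pos_le_mul_add_div (by positivity) (by positivity) (by positivity) hsq
  calc ‖f x‖ ^ 4 = (‖f x‖ ^ 2) ^ 2 := by ring
    _ ≤ _ := this
    _ = _ := by ring

/-- Agmon's inequality for real-valued Schwartz functions. -/
theorem exists_pow_four_le :
    ∃ C : ℝ, 0 ≤ C ∧ ∀ (f : 𝓢(EuclideanSpace ℝ (Fin 3), ℝ)) (p q : ℝ), ∫ y, f y ^ 2 ≤ p →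
      (∀ i, ∫ y, coordDeriv i f y ^ 2 ≤ p) → (∀ i, ∫ y, coordDeriv i f y ^ 2 ≤ q) →
      (∀ i j, ∫ y, coordDeriv j (coordDeriv i f) y ^ 2 ≤ q) → ∀ x, f x ^ 4 ≤ C * (p * q) := by
  obtain ⟨C, hC, h⟩ := exists_norm_pow_four_le
  refine ⟨C * 48, by positivity, fun f p q h0 h1 h2 h3 x => ?_⟩
  have hp : 0 ≤ p := (integral_nonneg fun y => sq_nonneg (f y)).trans h0
  let c (g : 𝓢(EuclideanSpace ℝ (Fin 3), ℝ)) : 𝓢(EuclideanSpace ℝ (Fin 3), ℂ) :=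
    postcompCLM (𝕜 := ℝ) Complex.ofRealCLM g
  have hc : ∀ g y, ‖c g y‖ = |g y| := fun g y => by simp [c]
  have hd : ∀ i g, coordDeriv i (c g) = c (coordDeriv i g) := by
    intro i g
    ext y
    have hg := (Complex.ofRealCLM.hasFDerivAt (x := g y)).comp y (g.hasFDerivAt y)
    rw [lineDerivOp_apply_eq_fderiv]
    change fderiv ℝ (Complex.ofRealCLM ∘ g) y _ = Complex.ofRealCLM (coordDeriv i g y)
    rw [hg.fderiv, lineDerivOp_apply_eq_fderiv]
    rfl
  have hX : ∫ ξ, fourierDensity (c f) ξ ≤ 4 * p := by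
    rw [integral_fourierDensity]
    simp_rw [hd, hc, sq_abs]
    have := Finset.sum_le_sum fun i (_ : i ∈ Finset.univ) => h1 i
    simp only [Finset.sum_const, Finset.card_univ, Fintype.card_fin, nsmul_eq_mul] at this
    push_cast at this
    linarith
  have hY : ∑ i, ∫ ξ, fourierDensity (coordDeriv i (c f)) ξ ≤ 12 * q := by
    have hi : ∀ i ∈ Finset.univ, ∫ ξ, fourierDensity (coordDeriv i (c f)) ξ ≤ 4 * q := by
      intro i _
      rw [integral_fourierDensity]
      simp_rw [hd, hc, sq_abs]
      have := Finset.sum_le_sum fun j (_ : j ∈ Finset.univ) => h3 i j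
      simp only [Finset.sum_const, Finset.card_univ, Fintype.card_fin, nsmul_eq_mul] at this
      push_cast at this
      linarith [h2 i]
    refine (Finset.sum_le_sum hi).trans_eq ?_
    simp
    ring
  have hY0 : 0 ≤ ∑ i, ∫ ξ, fourierDensity (coordDeriv i (c f)) ξ :=
    Finset.sum_nonneg fun i _ => integral_nonneg (fourierDensity_nonneg _)
  have hx := h (c f) x
  rw [hc, Even.pow_abs (by decide)] at hx
  calc f x ^ 4 ≤ _ := hx
    _ ≤ C * (4 * p) * (12 * q) := by gcongr
    _ = _ := by ring

/-- Iterated partial derivative of a Schwartz function along a list of coordinates. -/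
noncomputable def listDeriv : List (Fin 3) → 𝓢(EuclideanSpace ℝ (Fin 3), ℝ) →
    𝓢(EuclideanSpace ℝ (Fin 3), ℝ)
  | [], f => f
  | i :: L, f => coordDeriv i (listDeriv L f)

theorem listDeriv_append_singleton (L : List (Fin 3)) (i : Fin 3)
    (f : 𝓢(EuclideanSpace ℝ (Fin 3), ℝ)) :
    listDeriv (L ++ [i]) f = listDeriv L (coordDeriv i f) := by
  induction L with
  | nil => rfl
  | cons j L ih => rw [List.cons_append, listDeriv, ih, listDeriv]

theorem listDeriv_add (L : List (Fin 3)) (f g : 𝓢(EuclideanSpace ℝ (Fin 3), ℝ)) :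
    listDeriv L (f + g) = listDeriv L f + listDeriv L g := by
  induction L with
  | nil => rfl
  | cons j L ih => rw [listDeriv, ih, listDeriv, listDeriv, coordDeriv, lineDerivOp_add]

theorem listDeriv_eq_iteratedLineDerivOp (L : List (Fin 3))
    (f : 𝓢(EuclideanSpace ℝ (Fin 3), ℝ)) :
    listDeriv L f = ∂^{fun l => EuclideanSpace.single (L.get l) (1 : ℝ)} f := by
  induction L with
  | nil => rfl
  | cons j L ih =>
    rw [listDeriv, ih]
    rfl

theorem integral_listDeriv_sq_le_sobNormSq {s : ℕ}
    (u : Fin 3 → 𝓢(EuclideanSpace ℝ (Fin 3), ℝ)) (k : Fin 3) {L : List (Fin 3)}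
    (hL : L.length ≤ s) : ∫ x, listDeriv L (u k) x ^ 2 ≤ sobNormSq s u := by
  have hint : ∀ (k : Fin 3) (j : ℕ) (i : Fin j → Fin 3), Integrable fun x =>
      (iteratedFDeriv ℝ j (fun y => u k y) x (fun l => EuclideanSpace.single (i l) 1)) ^ 2 := by
    intro k j i
    simpa only [iteratedLineDerivOp_eq_iteratedFDeriv] using
      integrable_sq (∂^{fun l => EuclideanSpace.single (i l) (1 : ℝ)} (u k))
  unfold sobNormSq
  refine le_trans ?_ (Finset.single_le_sum (f := fun j => ∫ x, ∑ k, ∑ i : Fin j → Fin 3,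
    (iteratedFDeriv ℝ j (fun y => u k y) x (fun l => EuclideanSpace.single (i l) 1)) ^ 2)
    (fun j _ => integral_nonneg fun x => Finset.sum_nonneg fun _ _ =>
      Finset.sum_nonneg fun _ _ => sq_nonneg _)
    (Finset.mem_range.2 (Nat.lt_succ_of_le hL)))
  refine integral_mono (integrable_sq _)
    (integrable_finsetSum _ fun k _ => integrable_finsetSum _ fun i _ => hint k _ i) fun x => ?_
  have h1 : listDeriv L (u k) x ^ 2 = (iteratedFDeriv ℝ L.length (fun y => u k y) x
      (fun l => EuclideanSpace.single (L.get l) 1)) ^ 2 := by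
    rw [listDeriv_eq_iteratedLineDerivOp, iteratedLineDerivOp_eq_iteratedFDeriv]
  dsimp only
  rw [h1]
  refine le_trans ?_ (Finset.single_le_sum (f := fun k => ∑ i : Fin L.length → Fin 3,
    (iteratedFDeriv ℝ L.length (fun y => u k y) x (fun l => EuclideanSpace.single (i l) 1)) ^ 2)
    (fun _ _ => Finset.sum_nonneg fun _ _ => sq_nonneg _) (Finset.mem_univ k))
  exact Finset.single_le_sum (f := fun i : Fin L.length → Fin 3 =>
    (iteratedFDeriv ℝ L.length (fun y => u k y) x (fun l => EuclideanSpace.single (i l) 1)) ^ 2)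
    (fun _ _ => sq_nonneg _) (Finset.mem_univ L.get)

theorem SchwartzMap.integrable_mul (f g : 𝓢(EuclideanSpace ℝ (Fin 3), ℝ)) :
    Integrable fun x => f x * g x :=
  (pairing (ContinuousLinearMap.mul ℝ ℝ) f g).integrable

theorem sq_integral_mul_le (f g : 𝓢(EuclideanSpace ℝ (Fin 3), ℝ)) :
    (∫ x, f x * g x) ^ 2 ≤ (∫ x, f x ^ 2) * ∫ x, g x ^ 2 := by
  have h : ∀ t : ℝ, 0 < t →
      2 * |∫ x, f x * g x| ≤ t * (∫ x, f x ^ 2) + (∫ x, g x ^ 2) / t := by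
    intro t ht
    calc 2 * |∫ x, f x * g x| ≤ 2 * ∫ x, |f x * g x| := by
          gcongr; exact abs_integral_le_integral_abs
      _ = ∫ x, 2 * |f x * g x| := (integral_const_mul _ _).symm
      _ ≤ ∫ x, (t * f x ^ 2 + g x ^ 2 / t) := by
          refine integral_mono ((integrable_mul f g).abs.const_mul 2)
            ((f.integrable_sq.const_mul t).add (g.integrable_sq.div_const t)) fun x => ?_
          have h1 : t * f x ^ 2 + g x ^ 2 / t - 2 * |f x * g x| = (t * |f x| - |g x|) ^ 2 / t := by
            rw [abs_mul, ← sq_abs (f x), ← sq_abs (g x)]; field_simp; ring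
          have h2 : 0 ≤ (t * |f x| - |g x|) ^ 2 / t := by positivity
          dsimp only
          linarith
      _ = _ := by
          rw [integral_add (f.integrable_sq.const_mul t) (g.integrable_sq.div_const t),
            integral_const_mul, integral_div]
  have := sq_le_of_forall_pos_le_mul_add_div (integral_nonneg fun x => sq_nonneg (f x))
    (integral_nonneg fun x => sq_nonneg (g x)) (by positivity) h
  rw [mul_pow, sq_abs] at this
  linarith

theorem integral_coordDeriv_mul (i : Fin 3) (f g : 𝓢(EuclideanSpace ℝ (Fin 3), ℝ)) :
    ∫ x, coordDeriv i f x * g x = -∫ x, f x * coordDeriv i g x := by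
  rw [integral_mul_lineDerivOp_right_eq_neg_left f g, neg_neg]

theorem abs_integral_listDeriv_mul_le {f g : 𝓢(EuclideanSpace ℝ (Fin 3), ℝ)} {p q : ℕ} {M N : ℝ}
    (hf : ∀ L : List (Fin 3), L.length ≤ p → ∫ x, listDeriv L f x ^ 2 ≤ M)
    (hg : ∀ L : List (Fin 3), L.length ≤ q → ∫ x, listDeriv L g x ^ 2 ≤ N)
    (L : List (Fin 3)) (hL : L.length ≤ p + q) :
    |∫ x, listDeriv L f x * g x| ≤ Real.sqrt (M * N) := by
  induction q generalizing g L with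
  | zero =>
    refine Real.abs_le_sqrt ((sq_integral_mul_le _ _).trans ?_)
    exact mul_le_mul (hf L hL) (hg [] le_rfl) (integral_nonneg fun x => sq_nonneg _)
      ((integral_nonneg fun x => sq_nonneg _).trans (hf L hL))
  | succ q ih =>
    match L, hL with
    | [], _ => exact ih (fun L hL => hg L (by omega)) [] (by simp)
    | i :: L, hL =>
      rw [listDeriv, integral_coordDeriv_mul, abs_neg]
      refine ih (fun B hB => ?_) L (by simp at hL; omega)
      rw [← listDeriv_append_singleton]
      exact hg _ (by simpa using hB)

/-- The operator `I - Δ` on Schwartz functions. -/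
noncomputable def schwartzOneMinusLaplacian :
    𝓢(EuclideanSpace ℝ (Fin 3), ℝ) →ₗ[ℝ] 𝓢(EuclideanSpace ℝ (Fin 3), ℝ) :=
  LinearMap.id - ∑ i : Fin 3,
    (lineDerivOpCLM ℝ 𝓢(EuclideanSpace ℝ (Fin 3), ℝ) (EuclideanSpace.single i (1 : ℝ))
      ∘L lineDerivOpCLM ℝ 𝓢(EuclideanSpace ℝ (Fin 3), ℝ) (EuclideanSpace.single i (1 : ℝ)) :
      𝓢(EuclideanSpace ℝ (Fin 3), ℝ) →L[ℝ] 𝓢(EuclideanSpace ℝ (Fin 3), ℝ)).toLinearMap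

theorem schwartzOneMinusLaplacian_apply (f : 𝓢(EuclideanSpace ℝ (Fin 3), ℝ)) :
    schwartzOneMinusLaplacian f = f - ∑ i, coordDeriv i (coordDeriv i f) := by
  simp [schwartzOneMinusLaplacian, LinearMap.sum_apply]

theorem oneMinusLaplacian_coe (f : 𝓢(EuclideanSpace ℝ (Fin 3), ℝ)) :
    oneMinusLaplacian f = schwartzOneMinusLaplacian f := by
  ext x
  have h : ∀ i : Fin 3, (fun y => fderiv ℝ f y (EuclideanSpace.single i 1)) = coordDeriv i f :=
    fun i => funext fun y => (lineDerivOp_apply_eq_fderiv _ f y).symm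
  rw [schwartzOneMinusLaplacian_apply, oneMinusLaplacian]
  simp only [h, sub_apply, sum_apply, coordDeriv, lineDerivOp_apply_eq_fderiv]

theorem iterate_oneMinusLaplacian_coe (n : ℕ) (f : 𝓢(EuclideanSpace ℝ (Fin 3), ℝ)) :
    oneMinusLaplacian^[n] f = (schwartzOneMinusLaplacian ^ n) f := by
  induction n generalizing f with
  | zero => rfl
  | succ n ih =>
    rw [Function.iterate_succ_apply, oneMinusLaplacian_coe, ih, pow_succ, Module.End.mul_apply]

theorem abs_integral_pow_oneMinusLaplacian_mul_le {f g : 𝓢(EuclideanSpace ℝ (Fin 3), ℝ)}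
    {p q : ℕ} {M N : ℝ}
    (hf : ∀ L : List (Fin 3), L.length ≤ p → ∫ x, listDeriv L f x ^ 2 ≤ M)
    (hg : ∀ L : List (Fin 3), L.length ≤ q → ∫ x, listDeriv L g x ^ 2 ≤ N)
    (n : ℕ) (L : List (Fin 3)) (hL : L.length + 2 * n ≤ p + q) :
    |∫ x, (schwartzOneMinusLaplacian ^ n) (listDeriv L f) x * g x|
      ≤ 4 ^ n * Real.sqrt (M * N) := by
  induction n generalizing L with
  | zero => simpa using abs_integral_listDeriv_mul_le hf hg L (by omega)
  | succ n ih =>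
    have h : ∀ x, (schwartzOneMinusLaplacian ^ (n + 1)) (listDeriv L f) x * g x =
        (schwartzOneMinusLaplacian ^ n) (listDeriv L f) x * g x -
        ∑ i, (schwartzOneMinusLaplacian ^ n) (listDeriv (i :: i :: L) f) x * g x := by
      intro x
      rw [pow_succ, Module.End.mul_apply, schwartzOneMinusLaplacian_apply, map_sub, map_sum,
        sub_apply, sum_apply, sub_mul, Finset.sum_mul]
      rfl
    simp_rw [h]
    rw [integral_sub (integrable_mul _ _) (integrable_finsetSum _ fun i _ => integrable_mul _ _),
      integral_finsetSum _ fun i _ => integrable_mul _ _]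
    refine (abs_sub _ _).trans ?_
    have h1 := ih L (by omega)
    have h2 : |∑ i, ∫ x, (schwartzOneMinusLaplacian ^ n) (listDeriv (i :: i :: L) f) x * g x| ≤
        3 * (4 ^ n * Real.sqrt (M * N)) := by
      refine (Finset.abs_sum_le_sum_abs _ _).trans ?_
      refine (Finset.sum_le_sum fun i _ => ih (i :: i :: L) ?_).trans_eq ?_
      · simp; omega
      · simp
    rw [pow_succ]
    linarith

/-- The pointwise product of Schwartz functions. -/
noncomputable abbrev schwartzMul (f g : 𝓢(EuclideanSpace ℝ (Fin 3), ℝ)) :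
    𝓢(EuclideanSpace ℝ (Fin 3), ℝ) :=
  pairing (ContinuousLinearMap.mul ℝ ℝ) f g

theorem coordDeriv_schwartzMul (i : Fin 3) (f g : 𝓢(EuclideanSpace ℝ (Fin 3), ℝ)) :
    coordDeriv i (schwartzMul f g) =
      schwartzMul (coordDeriv i f) g + schwartzMul f (coordDeriv i g) := by
  ext x
  rw [lineDerivOp_apply_eq_fderiv]
  change fderiv ℝ (fun y => f y * g y) x _ = coordDeriv i f x * g x + f x * coordDeriv i g x
  rw [fderiv_fun_mul f.differentiableAt g.differentiableAt, lineDerivOp_apply_eq_fderiv,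
    lineDerivOp_apply_eq_fderiv]
  simp
  ring

theorem integral_listDeriv_schwartzMul_sq_le {f g : 𝓢(EuclideanSpace ℝ (Fin 3), ℝ)} {K : ℝ}
    (L : List (Fin 3))
    (h : ∀ A B : List (Fin 3), A.length + B.length = L.length →
      ∫ x, (listDeriv A f x * listDeriv B g x) ^ 2 ≤ K) :
    ∫ x, listDeriv L (schwartzMul f g) x ^ 2 ≤ 4 ^ L.length * K := by
  induction L using List.reverseRecOn generalizing f g with
  | nil => simpa [listDeriv] using h [] [] rfl
  | append_singleton L i ih =>
    have h1 : ∫ x, listDeriv L (schwartzMul (coordDeriv i f) g) x ^ 2 ≤ 4 ^ L.length * K := by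
      refine ih fun A B hAB => ?_
      rw [← listDeriv_append_singleton]
      exact h _ _ (by simp; omega)
    have h2 : ∫ x, listDeriv L (schwartzMul f (coordDeriv i g)) x ^ 2 ≤ 4 ^ L.length * K := by
      refine ih fun A B hAB => ?_
      rw [← listDeriv_append_singleton]
      exact h _ _ (by simp; omega)
    rw [listDeriv_append_singleton, coordDeriv_schwartzMul, listDeriv_add, List.length_append,
      List.length_singleton, pow_succ]
    set F := listDeriv L (schwartzMul (coordDeriv i f) g)
    set G := listDeriv L (schwartzMul f (coordDeriv i g))
    calc ∫ x, (F + G) x ^ 2 ≤ ∫ x, (2 * F x ^ 2 + 2 * G x ^ 2) := by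
          refine integral_mono (integrable_sq _)
            ((F.integrable_sq.const_mul 2).add (G.integrable_sq.const_mul 2)) fun x => ?_
          simp only [add_apply]
          nlinarith [sq_nonneg (F x - G x)]
      _ = 2 * (∫ x, F x ^ 2) + 2 * ∫ x, G x ^ 2 := by
          rw [integral_add (F.integrable_sq.const_mul 2) (G.integrable_sq.const_mul 2),
            integral_const_mul, integral_const_mul]
      _ ≤ _ := by linarith

theorem integral_mul_sq_pow_four_le {f g : 𝓢(EuclideanSpace ℝ (Fin 3), ℝ)} {S n : ℝ}
    (hf : ∀ x, f x ^ 4 ≤ S) (hg : ∫ x, g x ^ 2 ≤ n) :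
    (∫ x, (f x * g x) ^ 2) ^ 4 ≤ S ^ 2 * n ^ 4 := by
  have hS : 0 ≤ S := (by positivity : (0 : ℝ) ≤ f 0 ^ 4).trans (hf 0)
  have h0 : 0 ≤ ∫ x, (f x * g x) ^ 2 := integral_nonneg fun x => sq_nonneg _
  have h : ∫ x, (f x * g x) ^ 2 ≤ Real.sqrt S * n := by
    calc ∫ x, (f x * g x) ^ 2 ≤ ∫ x, Real.sqrt S * g x ^ 2 := by
          refine integral_mono (integrable_sq (schwartzMul f g))
            (g.integrable_sq.const_mul _) fun x => ?_
          dsimp only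
          rw [mul_pow]
          gcongr
          refine Real.le_sqrt_of_sq_le ?_
          rw [← pow_mul]
          exact hf x
      _ = Real.sqrt S * ∫ x, g x ^ 2 := integral_const_mul _ _
      _ ≤ _ := by gcongr
  calc _ ≤ (Real.sqrt S * n) ^ 4 := by gcongr
    _ = (Real.sqrt S ^ 2) ^ 2 * n ^ 4 := by ring
    _ = _ := by rw [Real.sq_sqrt hS]

theorem integral_listDeriv_sq_le_sqrt {f : 𝓢(EuclideanSpace ℝ (Fin 3), ℝ)} {s : ℕ} {x z : ℝ}
    (hx : ∀ L : List (Fin 3), L.length ≤ s → ∫ y, listDeriv L f y ^ 2 ≤ x)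
    (hz : ∀ L : List (Fin 3), L.length ≤ s + 2 → ∫ y, listDeriv L f y ^ 2 ≤ z)
    (L : List (Fin 3)) (hL : L.length ≤ s + 1) :
    ∫ y, listDeriv L f y ^ 2 ≤ Real.sqrt (x * z) := by
  have hx0 : 0 ≤ x := (integral_nonneg fun y => sq_nonneg _).trans (hx [] (by simp))
  refine Real.le_sqrt_of_sq_le ?_
  rcases Nat.lt_or_ge s L.length with h | h
  · match L, hL, h with
    | i :: L, hL, h =>
      have hLs : L.length ≤ s := by simpa using hL
      have h1 : ∫ y, listDeriv (i :: L) f y ^ 2 =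
          -∫ y, listDeriv L f y * listDeriv (i :: i :: L) f y := by
        simp_rw [sq]
        exact integral_coordDeriv_mul i _ _
      rw [h1, neg_sq]
      refine (sq_integral_mul_le _ _).trans ?_
      exact mul_le_mul (hx L hLs) (hz _ (by simpa using hLs))
        (integral_nonneg fun y => sq_nonneg _) hx0
  · rw [sq]
    exact mul_le_mul (hx L h) (hz L (by omega)) (integral_nonneg fun y => sq_nonneg _) hx0

theorem exists_integral_listDeriv_mul_sq_pow_four_le :
    ∃ C : ℝ, 0 ≤ C ∧ ∀ (s : ℕ) (f g : 𝓢(EuclideanSpace ℝ (Fin 3), ℝ)) (x z : ℝ), 1 ≤ s →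
      (∀ L : List (Fin 3), L.length ≤ s → ∫ y, listDeriv L f y ^ 2 ≤ x) →
      (∀ L : List (Fin 3), L.length ≤ s + 2 → ∫ y, listDeriv L f y ^ 2 ≤ z) →
      (∀ L : List (Fin 3), L.length ≤ s → ∫ y, listDeriv L g y ^ 2 ≤ x) →
      (∀ L : List (Fin 3), L.length ≤ s + 2 → ∫ y, listDeriv L g y ^ 2 ≤ z) →
      ∀ (A B : List (Fin 3)) (i : Fin 3), A.length + B.length ≤ s →
        (∫ y, (listDeriv A f y * listDeriv B (coordDeriv i g) y) ^ 2) ^ 4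
          ≤ C * (x ^ 5 * z ^ 3) := by
  obtain ⟨C, hC, agmon⟩ := exists_pow_four_le
  refine ⟨C ^ 2, sq_nonneg C, fun s f g x z hs hfx hfz hgx hgz A B i hAB => ?_⟩
  have hx0 : 0 ≤ x := (integral_nonneg fun y => sq_nonneg _).trans (hfx [] (by simp))
  have hz0 : 0 ≤ z := (integral_nonneg fun y => sq_nonneg _).trans (hfz [] (by simp))
  have hfy := integral_listDeriv_sq_le_sqrt hfx hfz
  have hgy := integral_listDeriv_sq_le_sqrt hgx hgz
  have hy := Real.sq_sqrt (mul_nonneg hx0 hz0)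
  set y := Real.sqrt (x * z)
  rw [← listDeriv_append_singleton]
  rcases Nat.lt_or_ge B.length s with hB | hB
  · have hA : ∀ w, listDeriv A f w ^ 4 ≤ C * (y * z) :=
      agmon _ _ _ (hfy A (by omega)) (fun j => hfy (j :: A) (by simp; omega))
        (fun j => hfz (j :: A) (by simp; omega)) (fun j k => hfz (k :: j :: A) (by simp; omega))
    refine (integral_mul_sq_pow_four_le hA (hgx (B ++ [i]) (by simp; omega))).trans_eq ?_
    linear_combination C ^ 2 * z ^ 2 * x ^ 4 * hy
  · obtain rfl : A = [] := List.length_eq_zero_iff.1 (by omega)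
    have hA : ∀ w, listDeriv [] f w ^ 4 ≤ C * (x * y) :=
      agmon _ _ _ (hfx [] (by simp)) (fun j => hfx [j] (by simpa using hs))
        (fun j => hfy [j] (by simp)) (fun j k => hfy [k, j] (by simpa using hs))
    refine (integral_mul_sq_pow_four_le hA (hgy (B ++ [i]) (by simp at hAB ⊢; omega))).trans_eq ?_
    calc (C * (x * y)) ^ 2 * y ^ 4 = C ^ 2 * x ^ 2 * (y ^ 2) ^ 3 := by ring
      _ = _ := by rw [hy]; ring

theorem le_quarter_add_of_pow_eight_le {I x z D : ℝ} (hx : 0 ≤ x) (hz : 0 ≤ z)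
    (hD : 0 ≤ D) (h : I ^ 8 ≤ D * (x ^ 5 * z ^ 7)) :
    I ≤ 1 / 4 * z + (4 ^ 7 * D + 1) * x ^ 5 := by
  have hx5 : 0 ≤ x ^ 5 := by positivity
  rcases le_or_gt I (1 / 4 * z) with h1 | h1
  · have : 0 ≤ (4 ^ 7 * D + 1) * x ^ 5 := by positivity
    linarith
  · have hI0 : 0 < I := lt_of_le_of_lt (by positivity) h1
    have h2 : I * I ^ 7 ≤ 4 ^ 7 * D * x ^ 5 * I ^ 7 := by
      calc I * I ^ 7 = I ^ 8 := by ring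
        _ ≤ D * (x ^ 5 * z ^ 7) := h
        _ ≤ D * (x ^ 5 * (4 * I) ^ 7) := by gcongr; linarith
        _ = _ := by ring
    have h3 := le_of_mul_le_mul_right h2 (by positivity)
    nlinarith

theorem exists_abs_integral_transport_pow_eight_le (s : ℕ) (hs : 1 ≤ s) :
    ∃ D : ℝ, 0 ≤ D ∧ ∀ (f g : 𝓢(EuclideanSpace ℝ (Fin 3), ℝ)) (x z : ℝ),
      (∀ L : List (Fin 3), L.length ≤ s → ∫ y, listDeriv L f y ^ 2 ≤ x) →
      (∀ L : List (Fin 3), L.length ≤ s + 2 → ∫ y, listDeriv L f y ^ 2 ≤ z) →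
      (∀ L : List (Fin 3), L.length ≤ s → ∫ y, listDeriv L g y ^ 2 ≤ x) →
      (∀ L : List (Fin 3), L.length ≤ s + 2 → ∫ y, listDeriv L g y ^ 2 ≤ z) →
      ∀ i, |∫ y, (schwartzOneMinusLaplacian ^ (s + 1)) g y * (f y * coordDeriv i g y)| ^ 8
        ≤ D * (x ^ 5 * z ^ 7) := by
  obtain ⟨C, hC, h⟩ := exists_integral_listDeriv_mul_sq_pow_four_le
  refine ⟨(4 ^ (s + 1)) ^ 8 * ((4 ^ s) ^ 4 * C), by positivity,
    fun f g x z hfx hfz hgx hgz i => ?_⟩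
  have hx0 : 0 ≤ x := (integral_nonneg fun y => sq_nonneg _).trans (hfx [] (by simp))
  have hz0 : 0 ≤ z := (integral_nonneg fun y => sq_nonneg _).trans (hfz [] (by simp))
  set Q := Real.sqrt (Real.sqrt (C * (x ^ 5 * z ^ 3))) with hQ
  have hQ0 : 0 ≤ Q := Real.sqrt_nonneg _
  have hQ4 : Q ^ 4 = C * (x ^ 5 * z ^ 3) := by
    rw [show Q ^ 4 = (Q ^ 2) ^ 2 by ring, hQ, Real.sq_sqrt (Real.sqrt_nonneg _),
      Real.sq_sqrt (by positivity)]
  have hprod : ∀ L : List (Fin 3), L.length ≤ s →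
      ∫ y, listDeriv L (schwartzMul f (coordDeriv i g)) y ^ 2 ≤ 4 ^ s * Q := by
    intro L hL
    refine (integral_listDeriv_schwartzMul_sq_le (K := Q) L fun A B hAB => ?_).trans ?_
    · refine le_of_pow_le_pow_left₀ (n := 4) (by norm_num) hQ0 ?_
      rw [hQ4]
      exact h s f g x z hs hfx hfz hgx hgz A B i (by omega)
    · gcongr
      norm_num
  have key := abs_integral_pow_oneMinusLaplacian_mul_le hgz hprod (s + 1) [] (by simp; omega)
  calc _ ≤ (4 ^ (s + 1) * Real.sqrt (z * (4 ^ s * Q))) ^ 8 := by gcongr; exact key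
    _ = (4 ^ (s + 1)) ^ 8 * (Real.sqrt (z * (4 ^ s * Q)) ^ 2) ^ 4 := by ring
    _ = (4 ^ (s + 1)) ^ 8 * ((4 ^ s) ^ 4 * z ^ 4 * Q ^ 4) := by
        rw [Real.sq_sqrt (by positivity)]; ring
    _ = _ := by rw [hQ4]; ring

/-- Higher-order transport estimate from the proof of Lemma 6.3: for each `m ≥ 2` there is
`C_m > 0` such that for every divergence-free Schwartz vector field `u : ℝ³ → ℝ³`,
`|∫ ⟨(I−Δ)^m u, (u·∇)u⟩ dx| ≤ ¼‖u‖_{m+1}² + C_m ‖u‖_{m−1}^{10}`. -/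
theorem stmt13 (m : ℕ) (hm : 2 ≤ m) :
    ∃ C : ℝ, 0 < C ∧ ∀ u : Fin 3 → SchwartzMap (EuclideanSpace ℝ (Fin 3)) ℝ,
      (∀ x, ∑ i, fderiv ℝ (fun y => u i y) x (EuclideanSpace.single i 1) = 0) →
      |∫ x, ∑ k, (oneMinusLaplacian^[m] (fun y => u k y)) x *
          (∑ i, u i x * fderiv ℝ (fun y => u k y) x (EuclideanSpace.single i 1))| ≤
        (1 / 4) * sobNormSq (m + 1) u + C * (sobNormSq (m - 1) u) ^ 5 := by
  obtain ⟨s, rfl⟩ : ∃ s, m = s + 1 := ⟨m - 1, by omega⟩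
  obtain ⟨D, hD, h⟩ := exists_abs_integral_transport_pow_eight_le s (by omega)
  refine ⟨4 ^ 7 * (9 ^ 8 * D) + 1, by positivity, fun u _ => ?_⟩
  rw [Nat.add_sub_cancel]
  have hx : ∀ k (L : List (Fin 3)), L.length ≤ s →
      ∫ y, listDeriv L (u k) y ^ 2 ≤ sobNormSq s u :=
    fun k L hL => integral_listDeriv_sq_le_sobNormSq u k hL
  have hz : ∀ k (L : List (Fin 3)), L.length ≤ s + 2 →
      ∫ y, listDeriv L (u k) y ^ 2 ≤ sobNormSq (s + 1 + 1) u :=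
    fun k L hL => integral_listDeriv_sq_le_sobNormSq u k hL
  set x := sobNormSq s u
  set z := sobNormSq (s + 1 + 1) u
  have hx0 : 0 ≤ x := (integral_nonneg fun y => sq_nonneg _).trans (hx 0 [] (by simp))
  have hz0 : 0 ≤ z := (integral_nonneg fun y => sq_nonneg _).trans (hz 0 [] (by simp))
  set J : Fin 3 → Fin 3 → ℝ := fun k i =>
    ∫ y, (schwartzOneMinusLaplacian ^ (s + 1)) (u k) y * (u i y * coordDeriv i (u k) y) with hJ
  have hsum : ∫ y, ∑ k, (oneMinusLaplacian^[s + 1] (fun y => u k y)) y *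
      (∑ i, u i y * fderiv ℝ (fun y => u k y) y (EuclideanSpace.single i 1)) =
      ∑ k, ∑ i, J k i := by
    have hint : ∀ k i, Integrable fun y =>
        (schwartzOneMinusLaplacian ^ (s + 1)) (u k) y * (u i y * coordDeriv i (u k) y) :=
      fun k i => integrable_mul _ (schwartzMul (u i) (coordDeriv i (u k)))
    simp only [hJ]
    simp_rw [← integral_finsetSum _ fun i _ => hint _ i]
    rw [← integral_finsetSum _ fun k _ => integrable_finsetSum _ fun i _ => hint k i]
    refine integral_congr_ae (.of_forall fun y => ?_)
    refine Finset.sum_congr rfl fun k _ => ?_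
    rw [Finset.mul_sum, iterate_oneMinusLaplacian_coe]
    refine Finset.sum_congr rfl fun i _ => ?_
    rw [lineDerivOp_apply_eq_fderiv]
  rw [hsum]
  refine le_quarter_add_of_pow_eight_le hx0 hz0 (by positivity) ?_
  obtain ⟨⟨k, i⟩, -, hmax⟩ := Finset.exists_max_image (Finset.univ : Finset (Fin 3 × Fin 3))
    (fun p => |J p.1 p.2|) Finset.univ_nonempty
  have hle : |∑ k, ∑ i, J k i| ≤ 9 * |J k i| := by
    rw [← Fintype.sum_prod_type']
    refine (Finset.abs_sum_le_sum_abs _ _).trans ((Finset.sum_le_sum hmax).trans_eq ?_)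
    simp
  calc |∑ k, ∑ i, J k i| ^ 8 ≤ (9 * |J k i|) ^ 8 := by gcongr
    _ = 9 ^ 8 * |J k i| ^ 8 := by ring
    _ ≤ 9 ^ 8 * (D * (x ^ 5 * z ^ 7)) := by
        gcongr
        exact h (u i) (u k) x z (hx i) (hz i) (hx k) (hz k) i
    _ = _ := by ring
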